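/- arXiv:1701.07478 — 2 statements merged into one kernel-verified Lean document; each statement's English description precedes it below -/
import Mathlib

section
/- Second-derivative formula for thermal Renyi divergences: Let n ≥ 1, E : Fin n → ℝ, β_R, β : ℝ, and let F(α) := (α − 1)⁻¹ · Real.log (Σ_i (ω β_R i)^α · (ω β i)^(1−α)). Then for every α < 1, writing β̃ := (β_R − β) · α + β, one has iteratedDeriv 2 F α = (2 / (1 − α)^3) · (Real.log (Z β_R) − Real.log (Z β̃) − (β̃ − β_R) · Eav β̃ − ((β̃ − β_R)^2 / 2) · Var β̃). -/
/-- Partition function of energies `E` at inverse temperature `t`. -/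
noncomputable def Zf {n : ℕ} (E : Fin n → ℝ) (t : ℝ) : ℝ := ∑ i, Real.exp (-t * E i)

/-- Gibbs distribution of energies `E` at inverse temperature `t`. -/
noncomputable def gibbs {n : ℕ} (E : Fin n → ℝ) (t : ℝ) (i : Fin n) : ℝ :=
  Real.exp (-t * E i) / Zf E t

/-- Thermal average energy. -/
noncomputable def Eav {n : ℕ} (E : Fin n → ℝ) (t : ℝ) : ℝ := ∑ i, E i * gibbs E t i

/-- Thermal energy variance. -/
noncomputable def Varf {n : ℕ} (E : Fin n → ℝ) (t : ℝ) : ℝ :=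
  (∑ i, (E i) ^ 2 * gibbs E t i) - (Eav E t) ^ 2

theorem Zf_pos {n : ℕ} (hn : 1 ≤ n) (E : Fin n → ℝ) (t : ℝ) : 0 < Zf E t :=
  Finset.sum_pos (fun _ _ => Real.exp_pos _) ⟨⟨0, hn⟩, Finset.mem_univ _⟩

theorem hasDerivAt_sum_mul_exp {n : ℕ} (c E : Fin n → ℝ) (t : ℝ) :
    HasDerivAt (fun s => ∑ i, c i * Real.exp (-s * E i))
      (-∑ i, c i * E i * Real.exp (-t * E i)) t := by
  rw [← Finset.sum_neg_distrib]
  refine HasDerivAt.fun_sum fun i _ => ?_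
  refine ((((hasDerivAt_id' t).fun_neg.mul_const (E i)).exp).const_mul (c i)).congr_deriv ?_
  ring

theorem Eav_eq_div {n : ℕ} (E : Fin n → ℝ) (t : ℝ) :
    Eav E t = (∑ i, E i * Real.exp (-t * E i)) / Zf E t := by
  simp only [Eav, gibbs, Finset.sum_div, mul_div_assoc]

theorem hasDerivAt_Zf {n : ℕ} (E : Fin n → ℝ) (t : ℝ) :
    HasDerivAt (Zf E) (-∑ i, E i * Real.exp (-t * E i)) t := by
  have h := hasDerivAt_sum_mul_exp (fun _ => 1) E t
  simp only [one_mul] at h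
  exact h

theorem hasDerivAt_log_Zf {n : ℕ} (hn : 1 ≤ n) (E : Fin n → ℝ) (t : ℝ) :
    HasDerivAt (fun s => Real.log (Zf E s)) (-Eav E t) t := by
  rw [Eav_eq_div, ← neg_div]
  exact (hasDerivAt_Zf E t).log (Zf_pos hn E t).ne'

theorem hasDerivAt_Eav {n : ℕ} (hn : 1 ≤ n) (E : Fin n → ℝ) (t : ℝ) :
    HasDerivAt (Eav E) (-Varf E t) t := by
  have hZ := (Zf_pos hn E t).ne'
  rw [funext (Eav_eq_div E)]
  refine ((hasDerivAt_sum_mul_exp E E t).fun_div (hasDerivAt_Zf E t) hZ).congr_deriv ?_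
  have hsq : ∑ i, E i ^ 2 * gibbs E t i = (∑ i, E i * E i * Real.exp (-t * E i)) / Zf E t := by
    simp only [gibbs, Finset.sum_div, mul_div_assoc, sq]
  rw [Varf, hsq, Eav_eq_div]
  generalize ∑ i, E i * E i * Real.exp (-t * E i) = M₂
  generalize ∑ i, E i * Real.exp (-t * E i) = M₁
  field_simp
  ring

theorem log_sum_gibbs_rpow {n : ℕ} (hn : 1 ≤ n) (E : Fin n → ℝ) (βR β a : ℝ) :
    Real.log (∑ i, gibbs E βR i ^ a * gibbs E β i ^ (1 - a)) =
      Real.log (Zf E ((βR - β) * a + β)) - a * Real.log (Zf E βR) -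
        (1 - a) * Real.log (Zf E β) := by
  have hR := Zf_pos hn E βR
  have hB := Zf_pos hn E β
  have hsum : ∑ i, gibbs E βR i ^ a * gibbs E β i ^ (1 - a) =
      Zf E ((βR - β) * a + β) / (Zf E βR ^ a * Zf E β ^ (1 - a)) := by
    rw [Zf, Finset.sum_div]
    refine Finset.sum_congr rfl fun i _ => ?_
    rw [gibbs, gibbs, Real.div_rpow (Real.exp_pos _).le hR.le,
      Real.div_rpow (Real.exp_pos _).le hB.le, ← Real.exp_mul, ← Real.exp_mul, div_mul_div_comm,
      ← Real.exp_add]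
    congr 2
    ring
  have hRa := Real.rpow_pos_of_pos hR a
  have hBa := Real.rpow_pos_of_pos hB (1 - a)
  rw [hsum, Real.log_div (Zf_pos hn E _).ne' (mul_pos hRa hBa).ne', Real.log_mul hRa.ne' hBa.ne',
    Real.log_rpow hR, Real.log_rpow hB]
  ring

theorem second_deriv_inv_sub_one_mul {G G' : ℝ → ℝ} {G'' α : ℝ} (hα : α ≠ 1)
    (hG : ∀ a, HasDerivAt G (G' a) a) (hG' : HasDerivAt G' G'' α) :
    iteratedDeriv 2 (fun a => (a - 1)⁻¹ * G a) α =
      (G'' * (α - 1) ^ 2 - 2 * G' α * (α - 1) + 2 * G α) / (α - 1) ^ 3 := by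
  have hinv : ∀ a : ℝ, a ≠ 1 → HasDerivAt (fun a : ℝ => (a - 1)⁻¹) (-1 / (a - 1) ^ 2) a :=
    fun a ha => ((hasDerivAt_id a).sub_const 1).fun_inv (sub_ne_zero.2 ha)
  have hfirst : deriv (fun a => (a - 1)⁻¹ * G a) =ᶠ[nhds α]
      fun a => (a - 1)⁻¹ * (G' a - (a - 1)⁻¹ * G a) := by
    filter_upwards [isOpen_ne.mem_nhds hα] with a ha
    rw [((hinv a ha).fun_mul (hG a)).deriv]
    have := sub_ne_zero.2 ha
    field_simp
    ring
  rw [iteratedDeriv_succ, iteratedDeriv_one, hfirst.deriv_eq,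
    ((hinv α hα).fun_mul (hG'.fun_sub ((hinv α hα).fun_mul (hG α)))).deriv]
  have := sub_ne_zero.2 hα
  field_simp
  ring

theorem second_derivative_thermal_renyi (n : ℕ) (hn : 1 ≤ n) (E : Fin n → ℝ)
    (βR β : ℝ) (α : ℝ) (hα : α < 1) :
    iteratedDeriv 2
      (fun a : ℝ => (a - 1)⁻¹ * Real.log (∑ i, gibbs E βR i ^ a * gibbs E β i ^ (1 - a)))
      α =
    (2 / (1 - α) ^ 3) *
      (Real.log (Zf E βR) - Real.log (Zf E ((βR - β) * α + β)) -
        (((βR - β) * α + β) - βR) * Eav E ((βR - β) * α + β) -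
        ((((βR - β) * α + β) - βR) ^ 2 / 2) * Varf E ((βR - β) * α + β)) := by
  have haff : ∀ a : ℝ, HasDerivAt (fun a => (βR - β) * a + β) (βR - β) a := fun a => by
    simpa using ((hasDerivAt_id a).const_mul (βR - β)).add_const β
  have hG : ∀ a : ℝ, HasDerivAt
      (fun a => Real.log (Zf E ((βR - β) * a + β)) - a * Real.log (Zf E βR) -
        (1 - a) * Real.log (Zf E β))
      (-Eav E ((βR - β) * a + β) * (βR - β) - Real.log (Zf E βR) + Real.log (Zf E β)) a := by
    intro a
    refine ((((hasDerivAt_log_Zf hn E _).comp a (haff a)).fun_sub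
      ((hasDerivAt_id a).mul_const (Real.log (Zf E βR)))).fun_sub
      (((hasDerivAt_id a).const_sub 1).mul_const (Real.log (Zf E β)))).congr_deriv ?_
    ring
  have hG' : HasDerivAt
      (fun a => -Eav E ((βR - β) * a + β) * (βR - β) - Real.log (Zf E βR) + Real.log (Zf E β))
      (Varf E ((βR - β) * α + β) * (βR - β) ^ 2) α := by
    refine (((((hasDerivAt_Eav hn E _).comp α (haff α)).fun_neg.mul_const (βR - β)).sub_const
      (Real.log (Zf E βR))).add_const (Real.log (Zf E β))).congr_deriv ?_
    ring
  simp only [log_sum_gibbs_rpow hn]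
  rw [second_deriv_inv_sub_one_mul hα.ne hG hG', show (1 - α) ^ 3 = -(α - 1) ^ 3 by ring]
  have := sub_ne_zero.2 hα.ne
  field_simp
  ring
end

section
/- Let c > 0. The function γ ↦ γ^3 · Real.sinh (γ · c) / (Real.sinh (γ · c / 2))^4 is antitone (monotonically nonincreasing) on Set.Ioi (0 : ℝ): for all 0 < γ₁ ≤ γ₂ one has γ₂^3 · Real.sinh (γ₂ c) / (Real.sinh (γ₂ c / 2))^4 ≤ γ₁^3 · Real.sinh (γ₁ c) / (Real.sinh (γ₁ c / 2))^4. -/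
theorem nonneg_of_hasDerivAt_nonneg {f f' : ℝ → ℝ} (hf : ∀ x, HasDerivAt f (f' x) x)
    (h0 : f 0 = 0) (hf' : ∀ x, 0 ≤ x → 0 ≤ f' x) {x : ℝ} (hx : 0 ≤ x) : 0 ≤ f x := by
  have hmono : MonotoneOn f (Set.Ici 0) := by
    refine monotoneOn_of_hasDerivWithinAt_nonneg (convex_Ici 0)
      (fun y _ => (hf y).continuousAt.continuousWithinAt)
      (fun y _ => (hf y).hasDerivWithinAt) fun y hy => hf' y ?_
    exact interior_subset hy
  simpa [h0] using hmono Set.self_mem_Ici hx hx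

theorem Real.sinh_le_self_mul_cosh {x : ℝ} (hx : 0 ≤ x) : Real.sinh x ≤ x * Real.cosh x := by
  refine sub_nonneg.mp (nonneg_of_hasDerivAt_nonneg
    (f := fun x => x * Real.cosh x - Real.sinh x) (f' := fun x => x * Real.sinh x)
    (fun y => ?_) (by simp) (fun y hy => mul_nonneg hy (Real.sinh_nonneg_iff.mpr hy)) hx)
  refine HasDerivAt.congr_deriv (((hasDerivAt_id' y).mul (Real.hasDerivAt_cosh y)).sub
    (Real.hasDerivAt_sinh y)) ?_
  ring

theorem Real.three_mul_sinh_le {x : ℝ} (hx : 0 ≤ x) :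
    3 * Real.sinh x ≤ x * (2 + Real.cosh x) := by
  have hderiv (y : ℝ) (hy : 0 ≤ y) : 0 ≤ 2 - 2 * Real.cosh y + y * Real.sinh y := by
    refine nonneg_of_hasDerivAt_nonneg
      (f := fun y => 2 - 2 * Real.cosh y + y * Real.sinh y)
      (f' := fun y => y * Real.cosh y - Real.sinh y)
      (fun z => ?_) (by simp) (fun z hz => sub_nonneg.mpr (Real.sinh_le_self_mul_cosh hz)) hy
    refine HasDerivAt.congr_deriv ((((Real.hasDerivAt_cosh z).const_mul 2).const_sub 2).add
      ((hasDerivAt_id' z).mul (Real.hasDerivAt_sinh z))) ?_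
    ring
  refine sub_nonneg.mp (nonneg_of_hasDerivAt_nonneg
    (f := fun x => x * (2 + Real.cosh x) - 3 * Real.sinh x) (fun y => ?_) (by simp) hderiv hx)
  refine HasDerivAt.congr_deriv
    (((hasDerivAt_id' y).mul ((Real.hasDerivAt_cosh y).const_add 2)).sub
      ((Real.hasDerivAt_sinh y).const_mul 3)) ?_
  ring

theorem Real.hasDerivAt_pow_three_mul_cosh_div_sinh_pow_three {a x : ℝ}
    (h : Real.sinh (x * a) ≠ 0) :
    HasDerivAt (fun x => x ^ 3 * Real.cosh (x * a) / Real.sinh (x * a) ^ 3)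
      (x ^ 2 * (3 * (Real.sinh (x * a) * Real.cosh (x * a))
        + x * a * (Real.sinh (x * a) ^ 2 - 3 * Real.cosh (x * a) ^ 2))
        / Real.sinh (x * a) ^ 4) x := by
  have hlin : HasDerivAt (fun x => x * a) a x := hasDerivAt_mul_const a
  refine HasDerivAt.congr_deriv (((hasDerivAt_pow 3 x).mul hlin.cosh).div
    (hlin.sinh.pow 3) (pow_ne_zero 3 h)) ?_
  simp only [Pi.mul_apply]
  field_simp
  push_cast
  ring

theorem sinh_ratio_antitone (c : ℝ) (hc : 0 < c) :
    AntitoneOn (fun γ : ℝ => γ ^ 3 * Real.sinh (γ * c) / (Real.sinh (γ * c / 2)) ^ 4)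
      (Set.Ioi (0:ℝ)) := by
  have hsinh (γ : ℝ) (hγ : 0 < γ) : 0 < Real.sinh (γ * (c / 2)) :=
    Real.sinh_pos_iff.mpr (by positivity)
  have hderiv (γ : ℝ) (hγ : 0 < γ) :=
    Real.hasDerivAt_pow_three_mul_cosh_div_sinh_pow_three (hsinh γ hγ).ne'
  have hanti : AntitoneOn
      (fun γ => γ ^ 3 * Real.cosh (γ * (c / 2)) / Real.sinh (γ * (c / 2)) ^ 3)
      (Set.Ioi (0:ℝ)) := by
    refine antitoneOn_of_hasDerivWithinAt_nonpos (convex_Ioi 0)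
      (fun γ hγ => (hderiv γ hγ).continuousAt.continuousWithinAt)
      (fun γ hγ => (hderiv γ (interior_subset hγ)).hasDerivWithinAt) fun γ hγ => ?_
    have hγ : 0 < γ := interior_subset hγ
    refine div_nonpos_of_nonpos_of_nonneg
      (mul_nonpos_of_nonneg_of_nonpos (by positivity) ?_) (by positivity)
    have key := Real.three_mul_sinh_le (x := 2 * (γ * (c / 2))) (by positivity)
    rw [Real.sinh_two_mul, Real.cosh_two_mul] at key
    linear_combination key / 2 - 2 * (γ * (c / 2)) * Real.cosh_sq (γ * (c / 2))
  refine ((monotone_mul_left_of_nonneg zero_le_two).comp_antitoneOn hanti).congr fun γ hγ => ?_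
  have hne := (hsinh γ hγ).ne'
  have hdouble : Real.sinh (γ * c) = 2 * Real.sinh (γ * (c / 2)) * Real.cosh (γ * (c / 2)) := by
    rw [← Real.sinh_two_mul]
    ring_nf
  simp only [Function.comp_apply, mul_div_assoc γ c 2, hdouble]
  field_simp
end
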